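/- For every unitary U on (ℂ^d)^{⊗n}, the magic entropy satisfies M[U] ≥ 0, and M[U] = 0 if and only if U is a Clifford unitary, i.e., for every ā ∈ V^n there exist b̄ ∈ V^n and a complex number ω with |ω| = 1 such that U P_ā U† = ω P_b̄. -/

import Mathlib

open Matrix Complex BigOperators
open scoped ComplexOrder
noncomputable section

namespace QC

/-- Operators on the `n`-qudit space `(ℂ^d)^{⊗n}`, as matrices indexed by
computational basis labels `Fin n → Fin d`. -/
abbrev QOp (d n : ℕ) := Matrix (Fin n → Fin d) (Fin n → Fin d) ℂ

/-- The qudit shift operator `X`, with `X|j⟩ = |j+1 mod d⟩`. -/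
def shiftX (d : ℕ) : Matrix (Fin d) (Fin d) ℂ :=
  fun i j => if (i : ℕ) = ((j : ℕ) + 1) % d then 1 else 0

/-- The qudit clock operator `Z`, with `Z|j⟩ = e^{2πij/d}|j⟩`. -/
def clockZ (d : ℕ) : Matrix (Fin d) (Fin d) ℂ :=
  Matrix.diagonal (fun j => Complex.exp (2 * Real.pi * Complex.I * (j : ℕ) / d))

/-- The single-qudit Pauli operator `P_a = X^s Z^t` for `a = (s,t) ∈ ℤ_d × ℤ_d`. -/
def pauli1 (d : ℕ) (a : ZMod d × ZMod d) : Matrix (Fin d) (Fin d) ℂ :=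
  shiftX d ^ a.1.val * clockZ d ^ a.2.val

/-- The `n`-qudit Pauli operator `P_ā = P_{a_1} ⊗ ⋯ ⊗ P_{a_n}`. -/
def pauliN (d n : ℕ) (a : Fin n → ZMod d × ZMod d) : QOp d n :=
  fun x y => ∏ i, pauli1 d (a i) (x i) (y i)

/-- The weight `|ā|`: the number of indices `i` with `a_i ≠ (0,0)`. -/
def weight (d n : ℕ) (a : Fin n → ZMod d × ZMod d) : ℕ :=
  (Finset.univ.filter (fun i => a i ≠ 0)).card

/-- `P_O[ā] = |Tr(O P_ā)|² / d^{2n}`. -/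
def pdist (d n : ℕ) (O : QOp d n) (a : Fin n → ZMod d × ZMod d) : ℝ :=
  ‖(O * pauliN d n a).trace‖ ^ 2 / (d : ℝ) ^ (2 * n)

/-- The normalized 2-norm `‖O‖₂ = (Tr(O†O)/d^n)^{1/2}`. -/
def l2norm (d n : ℕ) (O : QOp d n) : ℝ :=
  Real.sqrt (((Oᴴ * O).trace).re / (d : ℝ) ^ n)

/-- The total influence `I[O] = Σ_ā |ā|·P_O[ā]`. -/
def influence (d n : ℕ) [NeZero d] (O : QOp d n) : ℝ :=
  ∑ a : Fin n → ZMod d × ZMod d, (weight d n a : ℝ) * pdist d n O a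

/-- The local influence `I_j[O] = Σ_{ā : a_j ≠ 0} P_O[ā]`. -/
def localInfluence (d n : ℕ) [NeZero d] (j : Fin n) (O : QOp d n) : ℝ :=
  ∑ a ∈ Finset.univ.filter (fun a : Fin n → ZMod d × ZMod d => a j ≠ 0), pdist d n O a

/-- The quantum Fourier entropy `H[O] = -Σ_ā P_O[ā] log₂ P_O[ā]` (with `0·log 0 = 0`). -/
def qEntropy (d n : ℕ) [NeZero d] (O : QOp d n) : ℝ :=
  -∑ a : Fin n → ZMod d × ZMod d, pdist d n O a * Real.logb 2 (pdist d n O a)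

/-- The binary entropy `h(x) = -x log₂ x - (1-x) log₂ (1-x)`. -/
def binEntropy (x : ℝ) : ℝ :=
  -(x * Real.logb 2 x) - (1 - x) * Real.logb 2 (1 - x)

/-- Circuit sensitivity `CiS[U] = sup { |I[UOU†] - I[O]| : ‖O‖₂ = 1 }`. -/
def CiS (d n : ℕ) [NeZero d] (U : QOp d n) : ℝ :=
  sSup {x : ℝ | ∃ O : QOp d n, l2norm d n O = 1 ∧
    x = |influence d n (U * O * Uᴴ) - influence d n O|}

/-- Magic power `𝓜[U] = sup { |H[UOU†] - H[O]| : ‖O‖₂ = 1 }`. -/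
def magicPower (d n : ℕ) [NeZero d] (U : QOp d n) : ℝ :=
  sSup {x : ℝ | ∃ O : QOp d n, l2norm d n O = 1 ∧
    x = |qEntropy d n (U * O * Uᴴ) - qEntropy d n O|}

/-- Magic entropy `M[U] = max { H[U P_ā U†] : |ā| = 1 }`. -/
def magicEntropy (d n : ℕ) [NeZero d] (U : QOp d n) : ℝ :=
  sSup {x : ℝ | ∃ a : Fin n → ZMod d × ZMod d, weight d n a = 1 ∧
    x = qEntropy d n (U * pauliN d n a * Uᴴ)}

/-- The operator norm `‖A‖∞` (the L2 → L2 operator norm). -/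
def opNorm (d n : ℕ) (A : QOp d n) : ℝ :=
  ‖Matrix.toEuclideanCLM (𝕜 := ℂ) (n := Fin n → Fin d) A‖

/-- The influence rate `R_I(H,O)`. -/
def influenceRate (d n : ℕ) [NeZero d] (H O : QOp d n) : ℂ :=
  (Complex.I / (d : ℂ) ^ (2 * n)) * ∑ a : Fin n → ZMod d × ZMod d, (weight d n a : ℂ) *
    (((O * H - H * O) * pauliN d n a).trace * (O * (pauliN d n a)ᴴ).trace +
     ((O * H - H * O) * (pauliN d n a)ᴴ).trace * (O * pauliN d n a).trace)

/-- The magic rate `R_M(H,O)`. -/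
def magicRate (d n : ℕ) [NeZero d] (H O : QOp d n) : ℂ :=
  (Complex.I / (d : ℂ) ^ (2 * n)) * ∑ a : Fin n → ZMod d × ZMod d,
    (((O * H - H * O) * pauliN d n a).trace * (O * (pauliN d n a)ᴴ).trace +
     ((O * H - H * O) * (pauliN d n a)ᴴ).trace * (O * pauliN d n a).trace) *
    (Real.logb 2 (pdist d n O a) : ℂ)

/-- Extend an operator on the first `k` qudits by the identity: `H₀ ⊗ I`. -/
def extendOp (d k n : ℕ) (h : k ≤ n) (H0 : QOp d k) : QOp d n :=
  fun x y => if ∀ i : Fin n, k ≤ (i : ℕ) → x i = y i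
    then H0 (fun i => x (Fin.castLE h i)) (fun i => y (Fin.castLE h i)) else 0

/-- The tensor product `A ⊗ B` of an `n₁`-qudit and an `n₂`-qudit operator. -/
def tensorOp (d n₁ n₂ : ℕ) (A : QOp d n₁) (B : QOp d n₂) : QOp d (n₁ + n₂) :=
  fun x y => A (fun i => x (Fin.castAdd n₂ i)) (fun i => y (Fin.castAdd n₂ i)) *
             B (fun i => x (Fin.natAdd n₁ i)) (fun i => y (Fin.natAdd n₁ i))

/-- Embed a single-qudit operator `W` at position `j` (identity elsewhere). -/
def embedAt (d n : ℕ) (j : Fin n) (W : Matrix (Fin d) (Fin d) ℂ) : QOp d n :=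
  fun x y => if ∀ i, i ≠ j → x i = y i then W (x j) (y j) else 0

/-- The swap unitary exchanging qudits `i` and `j`. -/
def swapOp (d n : ℕ) (i j : Fin n) : QOp d n :=
  fun x y => if x = y ∘ Equiv.swap i j then 1 else 0

/-- The qubit Pauli X matrix. -/
def pauliX : Matrix (Fin 2) (Fin 2) ℂ := !![0, 1; 1, 0]

/-- The qubit Pauli Y matrix. -/
def pauliY : Matrix (Fin 2) (Fin 2) ℂ := !![0, -Complex.I; Complex.I, 0]

/-- The qubit Pauli Z matrix. -/
def pauliZ : Matrix (Fin 2) (Fin 2) ℂ := !![1, 0; 0, -1]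

/-- The ordered product `γ^S = ∏_{i∈S} γ_i` (factors in increasing index order). -/
def gammaProd (n : ℕ) (γ : Fin (2 * n) → QOp 2 n) (S : Finset (Fin (2 * n))) : QOp 2 n :=
  ((S.sort (· ≤ ·)).map γ).prod

/-- `P^G_O[S] = |Tr((γ^S)† O)|² / 2^{2n}`. -/
def pdistG (n : ℕ) (γ : Fin (2 * n) → QOp 2 n) (O : QOp 2 n) (S : Finset (Fin (2 * n))) : ℝ :=
  ‖((gammaProd n γ S)ᴴ * O).trace‖ ^ 2 / (2 : ℝ) ^ (2 * n)

/-- The Gaussian influence `I^G[O] = Σ_S |S|·P^G_O[S]`. -/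
def influenceG (n : ℕ) (γ : Fin (2 * n) → QOp 2 n) (O : QOp 2 n) : ℝ :=
  ∑ S : Finset (Fin (2 * n)), (S.card : ℝ) * pdistG n γ O S

/-- The Gaussian Fourier entropy `H^G[O] = -Σ_S P^G_O[S] log₂ P^G_O[S]`. -/
def entropyG (n : ℕ) (γ : Fin (2 * n) → QOp 2 n) (O : QOp 2 n) : ℝ :=
  -∑ S : Finset (Fin (2 * n)), pdistG n γ O S * Real.logb 2 (pdistG n γ O S)

/-- Gaussian circuit sensitivity `CiS^G[U] = sup { |I^G[UOU†] - I^G[O]| : ‖O‖₂ = 1 }`. -/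
def CiSG (n : ℕ) (γ : Fin (2 * n) → QOp 2 n) (U : QOp 2 n) : ℝ :=
  sSup {x : ℝ | ∃ O : QOp 2 n, l2norm 2 n O = 1 ∧
    x = |influenceG n γ (U * O * Uᴴ) - influenceG n γ O|}

/-- Fourier coefficient `f̂(S)` of a Boolean function `f : {-1,1}^n → ℝ`, with
the domain encoded as `Fin n → Bool` (`true ↦ -1`, `false ↦ 1`). -/
def fourierCoeff (n : ℕ) (f : (Fin n → Bool) → ℝ) (S : Finset (Fin n)) : ℝ :=
  (∑ x : Fin n → Bool, f x * ∏ i ∈ S, (if x i then -1 else 1)) / 2 ^ n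

/-- Fourier entropy of a Boolean function. -/
def boolEntropy (n : ℕ) (f : (Fin n → Bool) → ℝ) : ℝ :=
  -∑ S : Finset (Fin n), (fourierCoeff n f S) ^ 2 * Real.logb 2 ((fourierCoeff n f S) ^ 2)

/-- Total influence of a Boolean function. -/
def boolInfluence (n : ℕ) (f : (Fin n → Bool) → ℝ) : ℝ :=
  ∑ S : Finset (Fin n), (S.card : ℝ) * (fourierCoeff n f S) ^ 2

/-- The completely dephasing channel `Δ`. -/
def dephase (d n : ℕ) (A : QOp d n) : QOp d n :=
  Matrix.diagonal (fun i => A i i)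

/-- The diagonal matrix `log₂ Δ(ρ)` (entrywise base-2 logarithm of the diagonal). -/
def logDephase (d n : ℕ) (A : QOp d n) : QOp d n :=
  Matrix.diagonal (fun i => (Real.logb 2 (A i i).re : ℂ))

/-- The coherence rate `R_C(H,ρ) = -i Tr([ρ, log Δ(ρ)] H)`. -/
def cohRate (d n : ℕ) (H ρ : QOp d n) : ℂ :=
  -Complex.I * ((ρ * logDephase d n ρ - logDephase d n ρ * ρ) * H).trace

/-- The max-relative entropy `D_max(ρ‖σ) = log₂ min{λ > 0 : ρ ≤ λσ}`. -/
def Dmax (d n : ℕ) (ρ σ : QOp d n) : ℝ :=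
  Real.logb 2 (sInf {l : ℝ | 0 < l ∧ ((l : ℂ) • σ - ρ).PosSemidef})

section PauliAlgebra

variable {d n : ℕ} [NeZero d]

/-- The bijection between basis labels `Fin d` and residues modulo `d`. -/
def labelEquiv (d : ℕ) [NeZero d] : Fin d ≃ ZMod d :=
  Equiv.ofBijective (fun i => ((i : ℕ) : ZMod d)) <| by
    rw [Fintype.bijective_iff_injective_and_card]
    refine ⟨fun i j h => Fin.ext ?_, by simp⟩
    have h' := (ZMod.natCast_eq_natCast_iff' _ _ _).1 h
    rwa [Nat.mod_eq_of_lt i.2, Nat.mod_eq_of_lt j.2] at h'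

theorem labelEquiv_apply (i : Fin d) : labelEquiv d i = ((i : ℕ) : ZMod d) := rfl

theorem shiftX_apply (i j : Fin d) :
    shiftX d i j = if labelEquiv d i = labelEquiv d j + 1 then 1 else 0 := by
  have h : (i : ℕ) = ((j : ℕ) + 1) % d ↔ labelEquiv d i = labelEquiv d j + 1 := by
    rw [labelEquiv_apply, labelEquiv_apply, ← Nat.cast_succ,
      ZMod.natCast_eq_natCast_iff', Nat.mod_eq_of_lt i.2]
  simp only [shiftX, h]

theorem shiftX_pow_apply (s : ℕ) (i j : Fin d) :
    (shiftX d ^ s) i j = if labelEquiv d i = labelEquiv d j + s then 1 else 0 := by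
  induction s generalizing i with
  | zero => simp [Matrix.one_apply]
  | succ s ih =>
    rw [pow_succ', Matrix.mul_apply]
    simp only [ih, shiftX_apply]
    rw [(labelEquiv d).sum_comp
      (fun z => (if labelEquiv d i = z + 1 then (1 : ℂ) else 0) *
        if z = labelEquiv d j + s then 1 else 0)]
    simp [add_assoc]

theorem clockZ_eq :
    clockZ d = Matrix.diagonal fun j => ZMod.stdAddChar (labelEquiv d j) := by
  unfold clockZ
  congr 1
  funext j
  simpa [labelEquiv_apply] using (ZMod.stdAddChar_coe (N := d) ((j : ℕ) : ℤ)).symm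

theorem pauli1_apply (a : ZMod d × ZMod d) (i j : Fin d) :
    pauli1 d a i j = if labelEquiv d i = labelEquiv d j + a.1 then
      ZMod.stdAddChar (labelEquiv d j * a.2) else 0 := by
  rw [pauli1, clockZ_eq, Matrix.diagonal_pow, Matrix.mul_diagonal, shiftX_pow_apply,
    ZMod.natCast_zmod_val, Pi.pow_apply, ← AddChar.map_nsmul_eq_pow, nsmul_eq_mul,
    ZMod.natCast_zmod_val, mul_comm a.2]
  simp

theorem pauli1_mul (a b : ZMod d × ZMod d) :
    pauli1 d a * pauli1 d b = ZMod.stdAddChar (b.1 * a.2) • pauli1 d (a + b) := by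
  ext i j
  rw [Matrix.mul_apply, Matrix.smul_apply]
  simp only [pauli1_apply]
  rw [(labelEquiv d).sum_comp
      (fun z => (if labelEquiv d i = z + a.1 then ZMod.stdAddChar (z * a.2) else 0) *
        if z = labelEquiv d j + b.1 then
          (ZMod.stdAddChar (labelEquiv d j * b.2) : ℂ) else 0)]
  have h : labelEquiv d j + b.1 + a.1 = labelEquiv d j + (a.1 + b.1) := by ring
  simp only [mul_ite, mul_zero, Finset.sum_ite_eq', Finset.mem_univ, if_true, ite_mul, zero_mul,
    h, Prod.fst_add, Prod.snd_add, smul_eq_mul, ← AddChar.map_add_eq_mul]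
  congr 2
  ring

omit [NeZero d] in
theorem pauli1_zero : pauli1 d 0 = 1 := by simp [pauli1]

/-- Completeness of the single-qudit Pauli basis. -/
theorem sum_pauli1_mul_conj (x y z w : Fin d) :
    ∑ a, pauli1 d a x y * star (pauli1 d a z w) = if x = z ∧ y = w then (d : ℂ) else 0 := by
  have key (p q u v : ZMod d) : ∑ a : ZMod d × ZMod d,
      (if p = q + a.1 then (ZMod.stdAddChar (q * a.2) : ℂ) else 0) *
        star (if u = v + a.1 then (ZMod.stdAddChar (v * a.2) : ℂ) else 0) =
      if p = u ∧ q = v then (d : ℂ) else 0 := by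
    have hterm (s t : ZMod d) :
        (if p = q + s then (ZMod.stdAddChar (q * t) : ℂ) else 0) *
          star (if u = v + s then (ZMod.stdAddChar (v * t) : ℂ) else 0) =
        (if p = q + s ∧ u = v + s then 1 else 0) * ZMod.stdAddChar (t * (q - v)) := by
      have hc : star (ZMod.stdAddChar (v * t) : ℂ) = ZMod.stdAddChar (-(v * t)) := by
        rw [AddChar.map_neg_eq_conj]; rfl
      have hm : (ZMod.stdAddChar (t * (q - v)) : ℂ) =
          ZMod.stdAddChar (q * t) * ZMod.stdAddChar (-(v * t)) := by
        rw [← AddChar.map_add_eq_mul]; congr 1; ring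
      by_cases h1 : p = q + s <;> by_cases h2 : u = v + s <;> simp [h1, h2, hm, ← hc]
    rw [Fintype.sum_prod_type]
    simp only [hterm, ← Finset.mul_sum, AddChar.sum_mulShift _ (ZMod.isPrimitive_stdAddChar d),
      ← Finset.sum_mul, sub_eq_zero, ZMod.card]
    by_cases hq : q = v
    · subst hq
      have hs (s : ZMod d) : (p = q + s ∧ u = q + s) ↔ (s = p - q ∧ p = u) := by
        constructor
        · rintro ⟨rfl, rfl⟩; simp
        · rintro ⟨rfl, rfl⟩; simp
      simp only [hs]
      by_cases hp : p = u <;> simp [hp]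
    · simp [hq]
  simp only [pauli1_apply, key, EmbeddingLike.apply_eq_iff_eq]

theorem pauli1_mem_unitaryGroup (a : ZMod d × ZMod d) :
    pauli1 d a ∈ Matrix.unitaryGroup (Fin d) ℂ := by
  rw [Matrix.mem_unitaryGroup_iff]
  ext i j
  rw [Matrix.mul_apply, Matrix.one_apply]
  simp only [Matrix.star_apply, pauli1_apply]
  rw [(labelEquiv d).sum_comp
      (fun z => (if labelEquiv d i = z + a.1 then (ZMod.stdAddChar (z * a.2) : ℂ) else 0) *
        star (if labelEquiv d j = z + a.1 then (ZMod.stdAddChar (z * a.2) : ℂ) else 0))]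
  have hnorm (z : ZMod d) : (ZMod.stdAddChar z : ℂ) * star (ZMod.stdAddChar z : ℂ) = 1 := by
    have := Complex.mul_conj' (ZMod.stdAddChar z : ℂ)
    rwa [AddChar.norm_apply, Complex.ofReal_one, one_pow] at this
  rw [Finset.sum_eq_single (labelEquiv d i - a.1)]
  · by_cases hij : i = j
    · subst hij; simp only [sub_add_cancel, if_true, hnorm]
    · have : labelEquiv d j ≠ labelEquiv d i := fun h => hij ((labelEquiv d).injective h).symm
      simp [hij, this]
  · intro z _ hz
    have : labelEquiv d i ≠ z + a.1 := fun h => hz (by rw [h, add_sub_cancel_right])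
    simp [this]
  · simp

theorem pauliN_mul (a b : Fin n → ZMod d × ZMod d) :
    pauliN d n a * pauliN d n b =
      (∏ i, (ZMod.stdAddChar ((b i).1 * (a i).2) : ℂ)) • pauliN d n (a + b) := by
  ext x y
  simp only [Matrix.mul_apply, Matrix.smul_apply, pauliN, ← Finset.prod_mul_distrib, smul_eq_mul,
    Pi.add_apply]
  rw [← Fintype.prod_sum fun i z => pauli1 d (a i) (x i) z * pauli1 d (b i) z (y i)]
  refine Finset.prod_congr rfl fun i _ => ?_
  rw [← Matrix.mul_apply, pauli1_mul, Matrix.smul_apply, smul_eq_mul]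

theorem pauliN_mem_unitaryGroup (a : Fin n → ZMod d × ZMod d) :
    pauliN d n a ∈ Matrix.unitaryGroup (Fin n → Fin d) ℂ := by
  rw [Matrix.mem_unitaryGroup_iff]
  ext x y
  simp only [Matrix.mul_apply, Matrix.star_apply, pauliN, star_prod, ← Finset.prod_mul_distrib]
  rw [← Fintype.prod_sum fun i z => pauli1 d (a i) (x i) z * star (pauli1 d (a i) (y i) z)]
  have h (i : Fin n) : ∑ z, pauli1 d (a i) (x i) z * star (pauli1 d (a i) (y i) z) =
      if x i = y i then 1 else 0 := by
    have := congrFun₂ (Matrix.mem_unitaryGroup_iff.1 (pauli1_mem_unitaryGroup (a i))) (x i) (y i)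
    simpa only [Matrix.mul_apply, Matrix.star_apply, Matrix.one_apply] using this
  simp only [h, Finset.prod_ite_zero]
  simp [Matrix.one_apply, funext_iff]

theorem exists_pauliN_mul (a b : Fin n → ZMod d × ZMod d) :
    ∃ c : ℂ, ‖c‖ = 1 ∧ pauliN d n a * pauliN d n b = c • pauliN d n (a + b) :=
  ⟨_, by simp [norm_prod], pauliN_mul a b⟩

omit [NeZero d] in
theorem pauliN_zero : pauliN d n 0 = 1 := by
  ext x y
  simp [pauliN, pauli1_zero, Matrix.one_apply, Finset.prod_ite_zero, funext_iff]

/-- Completeness of the `n`-qudit Pauli basis. -/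
theorem sum_pauliN_mul_conj (x y z w : Fin n → Fin d) :
    ∑ a, pauliN d n a x y * star (pauliN d n a z w) =
      if x = z ∧ y = w then (d : ℂ) ^ n else 0 := by
  simp only [pauliN, star_prod, ← Finset.prod_mul_distrib]
  rw [← Fintype.prod_sum fun i a => pauli1 d a (x i) (y i) * star (pauli1 d a (z i) (w i))]
  simp only [sum_pauli1_mul_conj, Finset.prod_ite_zero, Finset.prod_const, Finset.card_univ,
    Fintype.card_fin, Finset.mem_univ, true_imp_iff, forall_and, funext_iff]

theorem sum_norm_trace_mul_pauliN_sq (O : QOp d n) :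
    ((∑ a, ‖(O * pauliN d n a).trace‖ ^ 2 : ℝ) : ℂ) = (d : ℂ) ^ n * (O * Oᴴ).trace := by
  have htr (a : Fin n → ZMod d × ZMod d) : (O * pauliN d n a).trace =
      ∑ p : (Fin n → Fin d) × (Fin n → Fin d), O p.2 p.1 * pauliN d n a p.1 p.2 := by
    simp only [Matrix.trace, Matrix.diag, Matrix.mul_apply]
    rw [Fintype.sum_prod_type_right]
  have hsq (a : Fin n → ZMod d × ZMod d) : ((‖(O * pauliN d n a).trace‖ ^ 2 : ℝ) : ℂ) =
      ∑ p : (Fin n → Fin d) × (Fin n → Fin d), ∑ q : (Fin n → Fin d) × (Fin n → Fin d),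
        O p.2 p.1 * star (O q.2 q.1) *
          (pauliN d n a p.1 p.2 * star (pauliN d n a q.1 q.2)) := by
    rw [Complex.ofReal_pow, ← Complex.mul_conj', htr, map_sum, Finset.sum_mul_sum]
    refine Finset.sum_congr rfl fun p _ => Finset.sum_congr rfl fun q _ => ?_
    rw [map_mul]
    simp only [starRingEnd_apply]
    ring
  rw [Complex.ofReal_sum]
  simp only [hsq]
  rw [Finset.sum_comm]
  simp only [Finset.sum_comm (s := Finset.univ (α := Fin n → ZMod d × ZMod d)),
    ← Finset.mul_sum, sum_pauliN_mul_conj, ← Prod.ext_iff]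
  simp only [mul_ite, mul_zero, Finset.sum_ite_eq, Finset.mem_univ, if_true, ← Finset.sum_mul]
  rw [mul_comm, Fintype.sum_prod_type_right]
  simp [Matrix.trace, Matrix.mul_apply, Matrix.conjTranspose_apply]

end PauliAlgebra

section Entropy

variable {d n : ℕ} [NeZero d]

omit [NeZero d] in
theorem pdist_nonneg (O : QOp d n) (a : Fin n → ZMod d × ZMod d) : 0 ≤ pdist d n O a := by
  unfold pdist; positivity

theorem sum_pdist_of_mem_unitaryGroup {O : QOp d n}
    (hO : O ∈ Matrix.unitaryGroup (Fin n → Fin d) ℂ) : ∑ a, pdist d n O a = 1 := by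
  have h := sum_norm_trace_mul_pauliN_sq O
  rw [← Matrix.star_eq_conjTranspose, Matrix.mem_unitaryGroup_iff.1 hO, Matrix.trace_one] at h
  simp only [Fintype.card_pi, Fintype.card_fin, Finset.prod_const, Finset.card_univ] at h
  have h' : ∑ a, ‖(O * pauliN d n a).trace‖ ^ 2 = (d : ℝ) ^ n * (d : ℝ) ^ n := by
    exact_mod_cast h
  have hd : (d : ℝ) ≠ 0 := NeZero.ne _
  simp only [pdist]
  rw [← Finset.sum_div, h', two_mul, pow_add, div_self (by positivity)]

theorem pdist_le_one {O : QOp d n} (hO : O ∈ Matrix.unitaryGroup (Fin n → Fin d) ℂ)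
    (a : Fin n → ZMod d × ZMod d) : pdist d n O a ≤ 1 := by
  rw [← sum_pdist_of_mem_unitaryGroup hO]
  exact Finset.single_le_sum (fun b _ => pdist_nonneg O b) (Finset.mem_univ a)

theorem pdist_mul_logb_nonpos {O : QOp d n} (hO : O ∈ Matrix.unitaryGroup (Fin n → Fin d) ℂ)
    (a : Fin n → ZMod d × ZMod d) : pdist d n O a * Real.logb 2 (pdist d n O a) ≤ 0 :=
  mul_nonpos_of_nonneg_of_nonpos (pdist_nonneg O a)
    (Real.logb_nonpos one_lt_two (pdist_nonneg O a) (pdist_le_one hO a))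

theorem qEntropy_nonneg {O : QOp d n} (hO : O ∈ Matrix.unitaryGroup (Fin n → Fin d) ℂ) :
    0 ≤ qEntropy d n O :=
  neg_nonneg.2 (Finset.sum_nonpos fun a _ => pdist_mul_logb_nonpos hO a)

/-- The entropy of a unitary vanishes iff its Pauli distribution is a point mass. -/
theorem qEntropy_eq_zero_iff {O : QOp d n} (hO : O ∈ Matrix.unitaryGroup (Fin n → Fin d) ℂ) :
    qEntropy d n O = 0 ↔ ∃ a, pdist d n O a = 1 := by
  rw [qEntropy, neg_eq_zero,
    Finset.sum_eq_zero_iff_of_nonpos fun a _ => pdist_mul_logb_nonpos hO a]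
  constructor
  · intro h
    obtain ⟨a, -, ha⟩ := Finset.exists_ne_zero_of_sum_ne_zero
      (by rw [sum_pdist_of_mem_unitaryGroup hO]; exact one_ne_zero :
        ∑ a, pdist d n O a ≠ 0)
    refine ⟨a, ?_⟩
    have hpos := (pdist_nonneg O a).lt_of_ne' ha
    have := (mul_eq_zero.1 (h a (Finset.mem_univ a))).resolve_left ha
    rw [← Real.logb_one (b := 2)] at this
    exact Real.logb_injOn_pos one_lt_two hpos (Set.mem_Ioi.2 one_pos) this
  · rintro ⟨a, ha⟩ b -
    by_cases hb : b = a
    · simp [hb, ha]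
    · have h1 := sum_pdist_of_mem_unitaryGroup hO
      rw [← Finset.add_sum_erase _ _ (Finset.mem_univ a), ha, add_eq_left,
        Finset.sum_eq_zero_iff_of_nonneg fun c _ => pdist_nonneg O c] at h1
      simp [h1 b (by simp [hb])]

/-- A unitary whose trace has maximal modulus is a phase. -/
theorem eq_smul_one_of_norm_trace_eq {ι : Type*} [Fintype ι] [DecidableEq ι] [Nonempty ι]
    {W : Matrix ι ι ℂ} (hW : W ∈ Matrix.unitaryGroup ι ℂ)
    (h : ‖W.trace‖ = Fintype.card ι) : ∃ w : ℂ, ‖w‖ = 1 ∧ W = w • (1 : Matrix ι ι ℂ) := by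
  have hN : (Fintype.card ι : ℂ) ≠ 0 := Nat.cast_ne_zero.2 Fintype.card_ne_zero
  refine ⟨W.trace / Fintype.card ι, ?_, ?_⟩
  · rw [norm_div, h, Complex.norm_natCast, div_self (Nat.cast_ne_zero.2 Fintype.card_ne_zero)]
  · rw [← sub_eq_zero, ← Matrix.trace_conjTranspose_mul_self_eq_zero_iff]
    have hu : Wᴴ * W = 1 := Matrix.mem_unitaryGroup_iff'.1 hW
    have hsq : W.trace * star W.trace = (Fintype.card ι : ℂ) ^ 2 := by
      have := Complex.mul_conj' W.trace
      rw [h] at this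
      exact_mod_cast this
    simp only [Matrix.conjTranspose_sub, Matrix.conjTranspose_smul, Matrix.conjTranspose_one,
      sub_mul, mul_sub, hu, Matrix.smul_mul, Matrix.mul_smul, one_mul, mul_one, Matrix.trace_sub,
      Matrix.trace_smul, Matrix.trace_one, Matrix.trace_conjTranspose, smul_eq_mul, star_div₀,
      star_natCast]
    field_simp
    linear_combination -hsq

/-- The Pauli distribution of a unitary is a point mass iff it is a phase times a Pauli. -/
theorem exists_pdist_eq_one_iff {O : QOp d n}
    (hO : O ∈ Matrix.unitaryGroup (Fin n → Fin d) ℂ) :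
    (∃ a, pdist d n O a = 1) ↔ ∃ (b : Fin n → ZMod d × ZMod d) (ω : ℂ), ‖ω‖ = 1 ∧
      O = ω • pauliN d n b := by
  have hd : (0 : ℝ) < (d : ℝ) ^ n := pow_pos (Nat.cast_pos.2 (NeZero.pos d)) n
  have hpd (a : Fin n → ZMod d × ZMod d) :
      pdist d n O a = 1 ↔ ‖(O * pauliN d n a).trace‖ = (d : ℝ) ^ n := by
    rw [pdist, mul_comm 2 n, pow_mul, div_eq_one_iff_eq (by positivity),
      pow_left_inj₀ (norm_nonneg _) hd.le two_ne_zero]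
  constructor
  · rintro ⟨a, ha⟩
    obtain ⟨w, hw, hOw⟩ := eq_smul_one_of_norm_trace_eq
      (mul_mem hO (pauliN_mem_unitaryGroup a)) (by rw [(hpd a).1 ha]; simp)
    obtain ⟨c, hc, hcP⟩ := exists_pauliN_mul a (-a)
    have hc0 : c ≠ 0 := norm_ne_zero_iff.1 (by simp [hc])
    refine ⟨-a, c⁻¹ * w, by simp [hc, hw], ?_⟩
    have := congrArg (· * pauliN d n (-a)) hOw
    simp only [Matrix.mul_assoc, hcP, add_neg_cancel, pauliN_zero, Matrix.mul_smul, mul_one,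
      Matrix.smul_mul, one_mul] at this
    rw [mul_smul, ← this, smul_smul, inv_mul_cancel₀ hc0, one_smul]
  · rintro ⟨b, ω, hω, rfl⟩
    obtain ⟨c, hc, hcP⟩ := exists_pauliN_mul b (-b)
    refine ⟨-b, (hpd _).2 ?_⟩
    simp [hcP, pauliN_zero, hc, hω, Matrix.trace_smul]

theorem qEntropy_eq_zero_iff_exists_eq_smul_pauliN {O : QOp d n}
    (hO : O ∈ Matrix.unitaryGroup (Fin n → Fin d) ℂ) :
    qEntropy d n O = 0 ↔ ∃ (b : Fin n → ZMod d × ZMod d) (ω : ℂ), ‖ω‖ = 1 ∧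
      O = ω • pauliN d n b :=
  (qEntropy_eq_zero_iff hO).trans (exists_pdist_eq_one_iff hO)

end Entropy

/-- A unitary mapping weight-one Paulis to Paulis up to phase does so for all Paulis. -/
theorem exists_conj_pauliN_eq_of_weight_one {d n : ℕ} [NeZero d] {U : QOp d n}
    (hU : U ∈ Matrix.unitaryGroup (Fin n → Fin d) ℂ)
    (h : ∀ a, weight d n a = 1 → ∃ (b : Fin n → ZMod d × ZMod d) (ω : ℂ), ‖ω‖ = 1 ∧
      U * pauliN d n a * Uᴴ = ω • pauliN d n b) (a : Fin n → ZMod d × ZMod d) :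
    ∃ (b : Fin n → ZMod d × ZMod d) (ω : ℂ), ‖ω‖ = 1 ∧
      U * pauliN d n a * Uᴴ = ω • pauliN d n b := by
  have hzero : ∃ (b : Fin n → ZMod d × ZMod d) (ω : ℂ), ‖ω‖ = 1 ∧
      U * pauliN d n 0 * Uᴴ = ω • pauliN d n b := by
    refine ⟨0, 1, norm_one, ?_⟩
    rw [pauliN_zero, mul_one, one_smul]
    exact Matrix.mem_unitaryGroup_iff.1 hU
  rw [← Finset.univ_sum_single a]
  refine Finset.sum_induction _ (fun a => ∃ (b : Fin n → ZMod d × ZMod d) (ω : ℂ), ‖ω‖ = 1 ∧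
      U * pauliN d n a * Uᴴ = ω • pauliN d n b) ?_ hzero fun i _ => ?_
  · rintro x y ⟨b₁, ω₁, h₁, e₁⟩ ⟨b₂, ω₂, h₂, e₂⟩
    obtain ⟨c, hc, hcP⟩ := exists_pauliN_mul x y
    obtain ⟨c', hc', hcP'⟩ := exists_pauliN_mul b₁ b₂
    have hc0 : c ≠ 0 := norm_ne_zero_iff.1 (by simp [hc])
    refine ⟨b₁ + b₂, c⁻¹ * (ω₁ * ω₂ * c'), by simp [hc, hc', h₁, h₂], ?_⟩
    have hu : Uᴴ * U = 1 := Matrix.mem_unitaryGroup_iff'.1 hU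
    have hprod : U * (pauliN d n x * pauliN d n y) * Uᴴ =
        (U * pauliN d n x * Uᴴ) * (U * pauliN d n y * Uᴴ) := by
      calc _ = U * pauliN d n x * 1 * pauliN d n y * Uᴴ := by noncomm_ring
        _ = _ := by rw [← hu]; noncomm_ring
    rw [e₁, e₂, hcP, Matrix.mul_smul, Matrix.smul_mul, Matrix.smul_mul, Matrix.mul_smul, hcP',
      smul_smul, smul_smul] at hprod
    rw [mul_smul, ← hprod, smul_smul, inv_mul_cancel₀ hc0, one_smul]
  · by_cases hi : a i = 0
    · simpa [hi] using hzero
    · refine h _ ?_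
      rw [weight, Finset.card_eq_one]
      refine ⟨i, ?_⟩
      ext j
      by_cases hj : j = i
      · subst hj; simp [hi]
      · simp [hj]

/-- **Faithfulness of the magic entropy**: `M[U] ≥ 0`, with equality iff `U` is
a Clifford unitary (maps every Pauli to a phase times a Pauli). -/
theorem magicEntropy_faithful (n d : ℕ) (hn : 1 ≤ n) (hd : 2 ≤ d) [NeZero d]
    (U : QOp d n) (hU : U ∈ Matrix.unitaryGroup (Fin n → Fin d) ℂ) :
    0 ≤ magicEntropy d n U ∧
    (magicEntropy d n U = 0 ↔ ∀ a : Fin n → ZMod d × ZMod d,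
      ∃ (b : Fin n → ZMod d × ZMod d) (ω : ℂ), ‖ω‖ = 1 ∧
        U * pauliN d n a * Uᴴ = ω • pauliN d n b) := by
  have hconj (a : Fin n → ZMod d × ZMod d) :
      U * pauliN d n a * Uᴴ ∈ Matrix.unitaryGroup (Fin n → Fin d) ℂ :=
    mul_mem (mul_mem hU (pauliN_mem_unitaryGroup a)) (Unitary.star_mem hU)
  refine ⟨Real.sSup_nonneg ?_, fun hM => ?_, fun hC => ?_⟩
  · rintro x ⟨a, -, rfl⟩
    exact qEntropy_nonneg (hconj a)
  · refine exists_conj_pauliN_eq_of_weight_one hU fun a ha => ?_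
    refine (qEntropy_eq_zero_iff_exists_eq_smul_pauliN (hconj a)).1
      (le_antisymm ?_ (qEntropy_nonneg (hconj a)))
    rw [← hM]
    refine le_csSup (Set.Finite.bddAbove ?_) ⟨a, ha, rfl⟩
    exact (Set.finite_range fun a => qEntropy d n (U * pauliN d n a * Uᴴ)).subset
      (by rintro x ⟨b, -, rfl⟩; exact ⟨b, rfl⟩)
  · refine le_antisymm (Real.sSup_nonpos ?_) (Real.sSup_nonneg ?_) <;> rintro x ⟨a, -, rfl⟩
    · exact ((qEntropy_eq_zero_iff_exists_eq_smul_pauliN (hconj a)).2 (hC a)).le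
    · exact qEntropy_nonneg (hconj a)

end QC
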